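/- Fix α, β ∈ ℝ. Define on ℝ[x] the operators τ̄ = L̄, τ̄^{(α,β)*} = −L̄ + (α−β)M̄₁ + (α+β)R̄₁ + R̄₂, μ̄^{(α)} = −L̄ + αM̄₁ + M̄₂, μ̄^{(β)*} = L̄ + βM̄₁ + M̄₂, and the Jacobi differential operator 𝒟̄ = (x²−1) d²/dx² + [(α−β) + (α+β+2)x] d/dx. Then the following four factorization identities hold as operator identities on ℝ[x]: 𝒟̄ = μ̄^{(α+1)} μ̄^{(β)*} − (α+1)β, 𝒟̄ = μ̄^{(β+1)*} μ̄^{(α)} − α(β+1), 𝒟̄ = τ̄^{(α+1,β+1)*} τ̄, and 𝒟̄ = τ̄ τ̄^{(α,β)*} − (α+β). -/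

import Mathlib

open Polynomial

/-- Differential S-Heun operator `L̄ = d/dx` on `ℝ[x]`. -/
noncomputable def Lb (p : ℝ[X]) : ℝ[X] := derivative p
/-- Differential S-Heun operator `M̄₁ = 1` (identity). -/
def M1b (p : ℝ[X]) : ℝ[X] := p
/-- Differential S-Heun operator `M̄₂ = x d/dx`. -/
noncomputable def M2b (p : ℝ[X]) : ℝ[X] := X * derivative p
/-- Differential S-Heun operator `R̄₁ = x` (multiplication by the variable). -/
noncomputable def R1b (p : ℝ[X]) : ℝ[X] := X * p
/-- Differential S-Heun operator `R̄₂ = x² d/dx`. -/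
noncomputable def R2b (p : ℝ[X]) : ℝ[X] := X^2 * derivative p

/-- The forward operator `τ̄ = L̄`. -/
noncomputable def taubar (p : ℝ[X]) : ℝ[X] := Lb p
/-- The backward operator `τ̄^{(α,β)*} = −L̄ + (α−β)M̄₁ + (α+β)R̄₁ + R̄₂`. -/
noncomputable def taubarS (α β : ℝ) (p : ℝ[X]) : ℝ[X] :=
  -(Lb p) + C (α - β) * M1b p + C (α + β) * R1b p + R2b p
/-- The contiguity operator `μ̄^{(α)} = −L̄ + αM̄₁ + M̄₂`. -/
noncomputable def mubar (α : ℝ) (p : ℝ[X]) : ℝ[X] := -(Lb p) + C α * M1b p + M2b p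
/-- The contiguity operator `μ̄^{(β)*} = L̄ + βM̄₁ + M̄₂`. -/
noncomputable def mubarS (β : ℝ) (p : ℝ[X]) : ℝ[X] := Lb p + C β * M1b p + M2b p
/-- The Jacobi differential operator
`𝒟̄ = (x²−1) d²/dx² + [(α−β) + (α+β+2)x] d/dx`. -/
noncomputable def Djac (α β : ℝ) (p : ℝ[X]) : ℝ[X] :=
  (X^2 - 1) * derivative (derivative p)
  + (C (α - β) + C (α + β + 2) * X) * derivative p

/-- Four factorizations of the Jacobi differential operator. -/
theorem stmt_5 (α β : ℝ) :
    (∀ p : ℝ[X], Djac α β p = mubar (α+1) (mubarS β p) - C ((α+1)*β) * p) ∧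
    (∀ p : ℝ[X], Djac α β p = mubarS (β+1) (mubar α p) - C (α*(β+1)) * p) ∧
    (∀ p : ℝ[X], Djac α β p = taubarS (α+1) (β+1) (taubar p)) ∧
    (∀ p : ℝ[X], Djac α β p = taubar (taubarS α β p) - C (α+β) * p) := by
  have h2 : (C (2:ℝ) : ℝ[X]) = 2 := rfl
  refine ⟨fun p => ?_, fun p => ?_, fun p => ?_, fun p => ?_⟩ <;>
  simp only [Djac, mubar, mubarS, taubar, taubarS, Lb, M1b, M2b, R1b, R2b, derivative_add,
    derivative_neg, derivative_sub, sub_zero, derivative_mul, derivative_C, derivative_X, derivative_X_pow, C_add, C_sub,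
    C_mul, C_1, h2, Nat.cast_ofNat] <;>
  ring
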